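/- Work on U = {(x,y,z) ∈ ℝ³ : x > 0 and y > 0}. With the Jacobi structure Λ^{12} = (e^{2x} − 1)/4, Λ^{13} = (e^{2x} − 1)/4, Λ^{23} = −½(y + z + 1 − e^{2x}), E = (0, −½, ½), the functions f₁ = y and f₂ = −2y·ln(y) satisfy {f₁, f₂} = f₁ on U, and the function h = ln(e^{2x} − 1) − e^{−2x}·ln(e^{2x} − 1) + y + z satisfies {h, f₁} = 0 and {h, f₂} = 0 on U; i.e., h is a t-independent constant of motion for the Lie system X = b₁(t)X_{f₁} + b₂(t)X_{f₂}. -/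

import Mathlib

open Real

/-- Partial derivative `∂_μ f` on `ℝ³`. -/
noncomputable def pd (μ : Fin 3) (f : (Fin 3 → ℝ) → ℝ) (p : Fin 3 → ℝ) : ℝ :=
  fderiv ℝ f p (Pi.single μ 1)

/-- The Jacobi bracket of `f, g`:
`{f,g} = Σ_{μ,ν} Λ^{μν}·(∂_μ f)·(∂_ν g) + f·(Eg) − g·(Ef)`. -/
noncomputable def jb (Λ : (Fin 3 → ℝ) → Fin 3 → Fin 3 → ℝ)
    (E : (Fin 3 → ℝ) → Fin 3 → ℝ) (f g : (Fin 3 → ℝ) → ℝ) (p : Fin 3 → ℝ) : ℝ :=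
  (∑ μ : Fin 3, ∑ ν : Fin 3, Λ p μ ν * pd μ f p * pd ν g p)
    + f p * (∑ μ : Fin 3, E p μ * pd μ g p)
    - g p * (∑ μ : Fin 3, E p μ * pd μ f p)

/-- The bivector with `Λ^{12} = (e^{2x} − 1)/4`, `Λ^{13} = (e^{2x} − 1)/4`,
`Λ^{23} = −½(y + z + 1 − e^{2x})`. -/
noncomputable def Lam : (Fin 3 → ℝ) → Fin 3 → Fin 3 → ℝ := fun p =>
  ![![0, (exp (2 * p 0) - 1) / 4, (exp (2 * p 0) - 1) / 4],
    ![-((exp (2 * p 0) - 1) / 4), 0, -((p 1 + p 2 + 1 - exp (2 * p 0)) / 2)],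
    ![-((exp (2 * p 0) - 1) / 4), (p 1 + p 2 + 1 - exp (2 * p 0)) / 2, 0]]

/-- The Reeb vector field `E = (0, −½, ½)`. -/
noncomputable def Evec : (Fin 3 → ℝ) → Fin 3 → ℝ := fun _ => ![0, -(1/2), 1/2]

/-- f₁ = y. -/
noncomputable def f₁ : (Fin 3 → ℝ) → ℝ := fun q => q 1

/-- f₂ = −2y·ln(y). -/
noncomputable def f₂ : (Fin 3 → ℝ) → ℝ := fun q => -(2 * q 1 * Real.log (q 1))

/-- h = ln(e^{2x} − 1) − e^{−2x}·ln(e^{2x} − 1) + y + z. -/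
noncomputable def h : (Fin 3 → ℝ) → ℝ := fun q =>
  Real.log (exp (2 * q 0) - 1) - exp (-(2 * q 0)) * Real.log (exp (2 * q 0) - 1)
    + q 1 + q 2

lemma pd_eq_of_hasFDerivAt {f : (Fin 3 → ℝ) → ℝ} {f' : (Fin 3 → ℝ) →L[ℝ] ℝ} {p : Fin 3 → ℝ}
    (hf : HasFDerivAt f f' p) (μ : Fin 3) : pd μ f p = f' (Pi.single μ 1) := by
  rw [pd, hf.fderiv]

lemma pd_f₁ (p : Fin 3 → ℝ) (μ : Fin 3) : pd μ f₁ p = ![0, 1, 0] μ := by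
  have hf : HasFDerivAt f₁ (ContinuousLinearMap.proj (R := ℝ) (φ := fun _ : Fin 3 => ℝ) 1) p :=
    hasFDerivAt_apply 1 p
  rw [pd_eq_of_hasFDerivAt hf]
  fin_cases μ <;> simp

lemma pd_f₂ {p : Fin 3 → ℝ} (hp : p 1 ≠ 0) (μ : Fin 3) :
    pd μ f₂ p = ![0, -(2 * Real.log (p 1) + 2), 0] μ := by
  have hg : HasDerivAt (fun y : ℝ => -(2 * y * Real.log y)) (-(2 * Real.log (p 1) + 2)) (p 1) := by
    refine HasDerivAt.congr_deriv
      (((hasDerivAt_id (p 1)).const_mul 2).mul (Real.hasDerivAt_log hp)).neg ?_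
    simp [hp]
  have hf := hg.comp_hasFDerivAt p (hasFDerivAt_apply (𝕜 := ℝ) 1 p)
  rw [pd_eq_of_hasFDerivAt (f := f₂) hf]
  fin_cases μ <;> simp

lemma pd_h {p : Fin 3 → ℝ} (hp : 0 < p 0) (μ : Fin 3) :
    pd μ h p = ![2 + 2 * exp (-(2 * p 0)) * Real.log (exp (2 * p 0) - 1), 1, 1] μ := by
  have hpos : exp (2 * p 0) - 1 ≠ 0 :=
    (sub_pos.2 (Real.one_lt_exp_iff.2 (by linarith))).ne'
  have hlin : HasDerivAt (fun x : ℝ => 2 * x) 2 (p 0) := by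
    simpa using (hasDerivAt_id (p 0)).const_mul 2
  have hlog := (hlin.exp.sub_const 1).log hpos
  have hg : HasDerivAt
      (fun x : ℝ => Real.log (exp (2 * x) - 1) - exp (-(2 * x)) * Real.log (exp (2 * x) - 1))
      (2 + 2 * exp (-(2 * p 0)) * Real.log (exp (2 * p 0) - 1)) (p 0) := by
    refine HasDerivAt.congr_deriv (hlog.sub (hlin.neg.exp.mul hlog)) ?_
    simp only [Pi.neg_apply, Real.exp_neg]
    have := Real.exp_ne_zero (2 * p 0)
    field_simp
    ring
  have hf :=
    ((hg.comp_hasFDerivAt p (hasFDerivAt_apply (𝕜 := ℝ) 0 p)).add (hasFDerivAt_apply 1 p)).add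
      (hasFDerivAt_apply 2 p)
  rw [pd_eq_of_hasFDerivAt (f := h) hf]
  fin_cases μ <;> simp

/-- On `U = {(x,y,z) : x > 0 and y > 0}` with the Jacobi structure `(Λ, E)`
above, the functions `f₁ = y` and `f₂ = −2y·ln(y)` satisfy `{f₁, f₂} = f₁`,
and `h = ln(e^{2x} − 1) − e^{−2x}·ln(e^{2x} − 1) + y + z` satisfies
`{h, f₁} = 0` and `{h, f₂} = 0`; i.e. `h` is a t-independent constant of
motion for the Lie system `X = b₁(t)X_{f₁} + b₂(t)X_{f₂}`. -/
theorem stmt_18 (p : Fin 3 → ℝ)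
    (hp : p ∈ {q : Fin 3 → ℝ | 0 < q 0 ∧ 0 < q 1}) :
    jb Lam Evec f₁ f₂ p = f₁ p ∧
    jb Lam Evec h f₁ p = 0 ∧
    jb Lam Evec h f₂ p = 0 := by
  obtain ⟨hx, hy⟩ := hp
  have he : exp (2 * p 0) * exp (-(2 * p 0)) = 1 := by rw [← Real.exp_add]; simp
  refine ⟨?_, ?_, ?_⟩
  · simp only [jb, pd_f₁, pd_f₂ hy.ne', Fin.sum_univ_three]
    simp [Lam, Evec, f₁, f₂]
    ring
  · simp only [jb, pd_f₁, pd_h hx, Fin.sum_univ_three]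
    simp [Lam, Evec, f₁, h]
    linear_combination (Real.log (exp (2 * p 0) - 1) / 2) * he
  · simp only [jb, pd_f₂ hy.ne', pd_h hx, Fin.sum_univ_three]
    simp [Lam, Evec, f₂, h]
    linear_combination
      (-(2 * Real.log (p 1) + 2) * Real.log (exp (2 * p 0) - 1) / 2) * he
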